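/- Let N ≥ 2 be an integer, η = 2π/N, a(θ) = −Γ(1 − θ/(2πi))·Γ(1 − 1/N + θ/(2πi)) / (Γ(1 + θ/(2πi))·Γ(1 − 1/N − θ/(2πi))), and b(θ) = a(θ)·θ/(θ − iη). (a) For every real θ > 0 the improper integral B(θ) = lim_{T→∞} ∫₀^T (−2i)·e^{t/N}·sinh(t/N)·sin(tθ/π) / (t·sinh t) dt exists in ℂ and exp(B(θ)) = −b(iπ − θ). (b) For every real θ, ∫₀^∞ e^{t/N}·sinh(t/N)·(1 − cos(tθ/π)) / (t·sinh² t) dt is absolutely convergent and unchanged under θ ↦ −θ. Parts (a) and (b) express that the minimal form factor G(θ) = exp J(θ), with J(θ) = ∫₀^∞ e^{t/N}·sinh(t/N)·(1 − cosh(t(1 − θ/(iπ)))) / (t·sinh² t) dt, satisfies Watson's equations G(θ) = −G(−θ)·b(iπ−θ) and G(iπ−θ) = G(iπ+θ): B(θ) is the combined integrand of J(θ) − J(−θ), and the integral in (b) equals J(iπ∓θ). -/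

import Mathlib

open Complex MeasureTheory Filter

theorem integral_exp_neg_mul_sin (u T : ℝ) {y : ℝ} (hy : y ≠ 0) :
    ∫ t in (0 : ℝ)..T, Real.exp (-(u * t)) * Real.sin (y * t) =
      (y - Real.exp (-(u * T)) * (u * Real.sin (y * T) + y * Real.cos (y * T))) /
        (u ^ 2 + y ^ 2) := by
  have hpos : u ^ 2 + y ^ 2 ≠ 0 := by positivity
  have hderiv : ∀ t ∈ Set.uIcc 0 T, HasDerivAt
      (fun t : ℝ => -(Real.exp (-(u * t)) * (u * Real.sin (y * t) + y * Real.cos (y * t))) /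
        (u ^ 2 + y ^ 2)) (Real.exp (-(u * t)) * Real.sin (y * t)) t := by
    intro t _
    have hyt : HasDerivAt (fun t : ℝ => y * t) y t := by
      simpa using (hasDerivAt_id t).const_mul y
    have hut : HasDerivAt (fun t : ℝ => -(u * t)) (-u) t := by
      simpa using ((hasDerivAt_id t).const_mul u).fun_neg
    have h := ((hut.exp.mul ((hyt.sin.const_mul u).add (hyt.cos.const_mul y))).neg).div_const
      (u ^ 2 + y ^ 2)
    convert! h using 1
    simp only [Pi.add_apply]
    field_simp
    ring
  rw [intervalIntegral.integral_eq_sub_of_hasDerivAt hderiv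
    (Continuous.intervalIntegrable (by fun_prop) _ _)]
  simp
  ring

theorem integral_exp_neg_mul (p q : ℝ) {t : ℝ} (ht : t ≠ 0) :
    ∫ u in p..q, Real.exp (-(u * t)) = (Real.exp (-(p * t)) - Real.exp (-(q * t))) / t := by
  have hderiv : ∀ u ∈ Set.uIcc p q,
      HasDerivAt (fun u : ℝ => -Real.exp (-(u * t)) / t) (Real.exp (-(u * t))) u := by
    intro u _
    have h : HasDerivAt (fun u : ℝ => -(u * t)) (-t) u := by
      simpa using ((hasDerivAt_id u).mul_const t).fun_neg
    convert! h.exp.neg.div_const t using 1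
    field_simp
  rw [intervalIntegral.integral_eq_sub_of_hasDerivAt hderiv
    (Continuous.intervalIntegrable (by fun_prop) _ _)]
  ring

theorem integral_exp_sub_exp_mul_sin_div (p q T : ℝ) {y : ℝ} (hy : y ≠ 0) :
    ∫ t in (0 : ℝ)..T, (Real.exp (-(p * t)) - Real.exp (-(q * t))) * (Real.sin (y * t) / t) =
      (Real.arctan (q / y) - Real.arctan (p / y)) -
        ∫ u in p..q, Real.exp (-(u * T)) *
          ((u * Real.sin (y * T) + y * Real.cos (y * T)) / (u ^ 2 + y ^ 2)) := by
  have hpos : ∀ u : ℝ, u ^ 2 + y ^ 2 ≠ 0 := fun u => by positivity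
  calc
    _ = ∫ t in (0 : ℝ)..T, ∫ u in p..q, Real.exp (-(u * t)) * Real.sin (y * t) := by
      refine intervalIntegral.integral_congr_ae ?_
      filter_upwards [Measure.ae_ne volume (0 : ℝ)] with t ht _
      rw [intervalIntegral.integral_mul_const, integral_exp_neg_mul p q ht]
      ring
    _ = ∫ u in p..q, ∫ t in (0 : ℝ)..T, Real.exp (-(u * t)) * Real.sin (y * t) := by
      refine MeasureTheory.intervalIntegral_intervalIntegral_swap ?_
      refine IntegrableOn.mono_set (t := Set.uIcc 0 T ×ˢ Set.uIcc p q) ?_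
        (Set.prod_mono Set.uIoc_subset_uIcc Set.uIoc_subset_uIcc)
      refine ContinuousOn.integrableOn_compact (isCompact_uIcc.prod isCompact_uIcc) ?_
      unfold Function.uncurry
      fun_prop
    _ = ∫ u in p..q, (y / (u ^ 2 + y ^ 2) - Real.exp (-(u * T)) *
          ((u * Real.sin (y * T) + y * Real.cos (y * T)) / (u ^ 2 + y ^ 2))) := by
      refine intervalIntegral.integral_congr fun u _ => ?_
      simp only [integral_exp_neg_mul_sin u T hy]
      ring
    _ = _ := by
      rw [intervalIntegral.integral_sub]
      · simp_rw [add_comm _ (y ^ 2), integral_div_sq_add_sq]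
      all_goals exact Continuous.intervalIntegrable (by fun_prop (disch := exact hpos _)) _ _

theorem tendsto_integral_exp_sub_exp_mul_sin_div {p q y : ℝ} (hp : 0 ≤ p) (hpq : p ≤ q)
    (hy : 0 < y) :
    Tendsto (fun T : ℝ => ∫ t in (0 : ℝ)..T,
        (Real.exp (-(p * t)) - Real.exp (-(q * t))) * (Real.sin (y * t) / t))
      atTop (nhds (Real.arctan (q / y) - Real.arctan (p / y))) := by
  simp_rw [integral_exp_sub_exp_mul_sin_div p q _ hy.ne']
  rw [← tendsto_sub_nhds_zero_iff]
  simp only [sub_sub_cancel_left]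
  refine squeeze_zero_norm' (a := fun T : ℝ => 2 / y * T⁻¹) ?_
    (by simpa using tendsto_inv_atTop_zero.const_mul (2 / y))
  filter_upwards [eventually_gt_atTop 0] with T hT
  rw [norm_neg]
  have hbound : ∀ u ∈ Set.Ioc p q, ‖Real.exp (-(u * T)) *
      ((u * Real.sin (y * T) + y * Real.cos (y * T)) / (u ^ 2 + y ^ 2))‖ ≤
      Real.exp (-(u * T)) * (2 / y) := by
    intro u hu
    have hu0 : 0 < u := hp.trans_lt hu.1
    rw [norm_mul, Real.norm_of_nonneg (Real.exp_pos _).le]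
    gcongr
    rw [norm_div, Real.norm_of_nonneg (by positivity : 0 ≤ u ^ 2 + y ^ 2), div_le_div_iff₀
      (by positivity) hy]
    have h : ‖u * Real.sin (y * T) + y * Real.cos (y * T)‖ ≤ u + y := by
      refine (norm_add_le _ _).trans (add_le_add ?_ ?_) <;>
        rw [norm_mul, Real.norm_of_nonneg (by positivity)]
      · exact mul_le_of_le_one_right hu0.le (Real.abs_sin_le_one _)
      · exact mul_le_of_le_one_right hy.le (Real.abs_cos_le_one _)
    nlinarith [mul_le_mul_of_nonneg_right h hy.le, sq_nonneg (u - y), sq_nonneg u]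
  calc
    _ ≤ ∫ u in p..q, Real.exp (-(u * T)) * (2 / y) :=
      intervalIntegral.norm_integral_le_of_norm_le hpq (Eventually.of_forall hbound)
        (Continuous.intervalIntegrable (by fun_prop) _ _)
    _ = (Real.exp (-(p * T)) - Real.exp (-(q * T))) / T * (2 / y) := by
      rw [intervalIntegral.integral_mul_const, integral_exp_neg_mul p q hT.ne']
    _ ≤ 1 / T * (2 / y) := by
      gcongr
      have h1 : Real.exp (-(p * T)) ≤ 1 := Real.exp_le_one_iff.2 (by nlinarith)
      linarith [Real.exp_pos (-(q * T))]
    _ = 2 / y * T⁻¹ := by ring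

theorem cexp_arctan_sub_arctan (p q : ℝ) {y : ℝ} (hy : 0 < y) :
    Complex.exp (-2 * I * ((Real.arctan (q / y) - Real.arctan (p / y) : ℝ) : ℂ)) =
      ((q + I * y) * (p - I * y)) / ((q - I * y) * (p + I * y)) := by
  have key : ∀ r : ℝ, Complex.exp (-2 * I * (Real.arctan (r / y) : ℂ)) =
      -((r + I * y) / (r - I * y)) := by
    intro r
    set A := Real.arctan (r / y)
    have hcos : Real.cos A ≠ 0 := (Real.cos_arctan_pos _).ne'
    have hsin : y * Real.sin A = r * Real.cos A := by
      have h : Real.tan A = r / y := Real.tan_arctan _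
      rw [Real.tan_eq_sin_div_cos] at h
      field_simp at h
      linarith
    have hne : (r : ℂ) - I * y ≠ 0 := fun h => by
      have := congrArg Complex.im h
      simp at this
      exact hy.ne' this
    have hy' : (y : ℂ) ≠ 0 := by exact_mod_cast hy.ne'
    have hA : -2 * I * (A : ℂ) = (-(A : ℂ) * I) - (A : ℂ) * I := by ring
    rw [hA, Complex.exp_sub, div_eq_iff (Complex.exp_ne_zero _), Complex.exp_mul_I,
      Complex.exp_mul_I, Complex.cos_neg, Complex.sin_neg, ← neg_div, div_mul_eq_mul_div,
      eq_div_iff hne, ← Complex.ofReal_cos, ← Complex.ofReal_sin]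
    have hs : (y : ℂ) * (Real.sin A : ℂ) = r * (Real.cos A : ℂ) := by exact_mod_cast hsin
    linear_combination (2 * I ^ 2) * hs + 2 * r * (Real.cos A : ℂ) * I_sq
  rw [Complex.ofReal_sub, mul_sub, Complex.exp_sub, key, key, neg_div_neg_eq, div_div_div_eq]

theorem tendsto_prod_Gamma_div {z₁ z₂ z₃ z₄ : ℂ} (hz : z₁ + z₂ = z₃ + z₄)
    (h₃ : ∀ m : ℕ, z₃ ≠ -m) (h₄ : ∀ m : ℕ, z₄ ≠ -m) :
    Tendsto (fun n : ℕ => ∏ k ∈ Finset.range n,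
        ((z₃ + k) * (z₄ + k)) / ((z₁ + k) * (z₂ + k))) atTop
      (nhds (Gamma z₁ * Gamma z₂ / (Gamma z₃ * Gamma z₄))) := by
  rw [← tendsto_add_atTop_iff_nat 1]
  have h := ((GammaSeq_tendsto_Gamma z₁).mul (GammaSeq_tendsto_Gamma z₂)).div
    ((GammaSeq_tendsto_Gamma z₃).mul (GammaSeq_tendsto_Gamma z₄))
    (mul_ne_zero (Gamma_ne_zero h₃) (Gamma_ne_zero h₄))
  refine h.congr' ?_
  filter_upwards [eventually_ne_atTop 0] with n hn
  have hn' : (n : ℂ) ≠ 0 := by exact_mod_cast hn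
  have hpow : (n : ℂ) ^ z₁ * (n : ℂ) ^ z₂ = (n : ℂ) ^ z₃ * (n : ℂ) ^ z₄ := by
    rw [← cpow_add _ _ hn', ← cpow_add _ _ hn', hz]
  have hfac : (n.factorial : ℂ) ≠ 0 := by exact_mod_cast n.factorial_ne_zero
  have hne₃ : (n : ℂ) ^ z₃ ≠ 0 := by simp [cpow_eq_zero_iff, hn']
  have hne₄ : (n : ℂ) ^ z₄ ≠ 0 := by simp [cpow_eq_zero_iff, hn']
  simp only [GammaSeq, Pi.div_apply]
  rw [Finset.prod_div_distrib, Finset.prod_mul_distrib, Finset.prod_mul_distrib]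
  set P₁ := ∏ k ∈ Finset.range (n + 1), (z₁ + (k : ℂ))
  set P₂ := ∏ k ∈ Finset.range (n + 1), (z₂ + (k : ℂ))
  set P₃ := ∏ k ∈ Finset.range (n + 1), (z₃ + (k : ℂ))
  set P₄ := ∏ k ∈ Finset.range (n + 1), (z₄ + (k : ℂ))
  calc
    _ = ((n : ℂ) ^ z₁ * (n : ℂ) ^ z₂) * n.factorial ^ 2 / (P₁ * P₂) /
        (((n : ℂ) ^ z₃ * (n : ℂ) ^ z₄) * n.factorial ^ 2 / (P₃ * P₄)) := by
      congr 1 <;> rw [div_mul_div_comm] <;> ring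
    _ = _ := by
      rw [hpow, div_div_div_eq]
      have hX : (n : ℂ) ^ z₃ * (n : ℂ) ^ z₄ * n.factorial ^ 2 ≠ 0 := by positivity
      rw [mul_comm (P₁ * P₂), mul_div_mul_left _ _ hX]

theorem exp_mul_sinh_div_sinh_mem_Icc {r t : ℝ} (hr : 2 ≤ r) (ht : 0 < t) :
    Real.exp (t / r) * Real.sinh (t / r) / Real.sinh t ∈ Set.Icc (0 : ℝ) 1 := by
  have hr0 : 0 < r := by linarith
  have hsinh : 0 < Real.sinh t := Real.sinh_pos_iff.2 ht
  have hle : t / r + t / r ≤ t := by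
    rw [← add_div, div_le_iff₀ hr0]
    nlinarith
  refine ⟨div_nonneg (mul_nonneg (Real.exp_pos _).le
    (Real.sinh_nonneg_iff.2 (by positivity))) hsinh.le, (div_le_one hsinh).2 ?_⟩
  have h₁ : Real.exp (t / r) * Real.exp (t / r) ≤ Real.exp t := by
    rw [← Real.exp_add]
    exact Real.exp_le_exp.2 hle
  have h₂ : Real.exp (t / r) * Real.exp (-(t / r)) = 1 := by
    rw [← Real.exp_add, add_neg_cancel, Real.exp_zero]
  have h₃ : Real.exp (-t) ≤ 1 := Real.exp_le_one_iff.2 (by linarith)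
  rw [Real.sinh_eq, Real.sinh_eq]
  linarith

theorem sum_exp_sub_exp_eq (r : ℝ) {t : ℝ} (ht : t ≠ 0) (n : ℕ) :
    ∑ k ∈ Finset.range n,
        (Real.exp (-((2 * k + 1 - 2 / r) * t)) - Real.exp (-((2 * k + 1) * t))) =
      Real.exp (t / r) * Real.sinh (t / r) / Real.sinh t * (1 - Real.exp (-(2 * n * t))) := by
  have hsinh : Real.sinh t ≠ 0 := Real.sinh_ne_zero.2 ht
  induction n with
  | zero => simp
  | succ n ih =>
    rw [Finset.sum_range_succ, ih]
    have e₁ : Real.exp (-((2 * n + 1 - 2 / r) * t)) =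
        Real.exp (-(2 * n * t)) * Real.exp (-t) * Real.exp (t / r) ^ 2 := by
      rw [sq, ← Real.exp_add, ← Real.exp_add, ← Real.exp_add]
      congr 1
      ring
    have e₂ : Real.exp (-((2 * n + 1) * t)) = Real.exp (-(2 * n * t)) * Real.exp (-t) := by
      rw [← Real.exp_add]
      congr 1
      ring
    have e₃ : Real.exp (-(2 * (n + 1 : ℕ) * t)) =
        Real.exp (-(2 * n * t)) * Real.exp (-t) * Real.exp (-t) := by
      rw [← Real.exp_add, ← Real.exp_add]
      congr 1
      push_cast
      ring
    have h₁ : Real.exp t * Real.exp (-t) = 1 := by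
      rw [← Real.exp_add, add_neg_cancel, Real.exp_zero]
    have h₂ : Real.exp (t / r) * Real.exp (-(t / r)) = 1 := by
      rw [← Real.exp_add, add_neg_cancel, Real.exp_zero]
    have hK : Real.exp (t / r) * Real.sinh (t / r) / Real.sinh t * (Real.exp t - Real.exp (-t)) =
        Real.exp (t / r) ^ 2 - 1 := by
      have h : Real.exp t - Real.exp (-t) = 2 * Real.sinh t := by
        rw [Real.sinh_eq]
        ring
      rw [h, mul_left_comm, div_mul_cancel₀ _ hsinh, Real.sinh_eq]
      linear_combination -h₂
    rw [e₁, e₂, e₃]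
    linear_combination (-(Real.exp (-(2 * n * t)) * Real.exp (-t))) * hK +
      Real.exp (t / r) * Real.sinh (t / r) / Real.sinh t * Real.exp (-(2 * n * t)) * h₁

theorem abs_sin_mul_div_le {y t : ℝ} (hy : 0 ≤ y) (ht : 0 < t) :
    |Real.sin (y * t) / t| ≤ y := by
  rw [abs_div, abs_of_pos ht, div_le_iff₀ ht]
  exact (Real.abs_sin_le_abs).trans_eq (abs_of_nonneg (by positivity))

theorem intervalIntegrable_mul_sin_div {g : ℝ → ℝ} (hg : Measurable g)
    (hbound : ∀ t, 0 < t → |g t| ≤ 1) {y : ℝ} (hy : 0 ≤ y) {T : ℝ} (hT : 0 ≤ T) :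
    IntervalIntegrable (fun t => g t * (Real.sin (y * t) / t)) volume 0 T := by
  rw [intervalIntegrable_iff_integrableOn_Ioc_of_le hT]
  refine Measure.integrableOn_of_bounded measure_Ioc_lt_top.ne
    (Measurable.aestronglyMeasurable (by fun_prop)) (M := y) ?_
  filter_upwards [ae_restrict_mem measurableSet_Ioc] with t ht
  rw [norm_mul]
  exact (mul_le_of_le_one_left (norm_nonneg _) (hbound t ht.1)).trans
    (abs_sin_mul_div_le hy ht.1)

theorem exists_tendsto_sum_arctan_sub_arctan {r y : ℝ} (hr : 2 ≤ r) (hy : 0 < y) :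
    ∃ L, Tendsto (fun n : ℕ => ∑ k ∈ Finset.range n,
      (Real.arctan ((2 * k + 1) / y) - Real.arctan ((2 * k + 1 - 2 / r) / y))) atTop (nhds L) := by
  have hr0 : 0 < r := by linarith
  have hr1 : 2 / r ≤ 1 := (div_le_one hr0).2 hr
  have hr2 : 0 < 2 / r := by positivity
  refine ⟨_, tendsto_atTop_ciSup (monotone_nat_of_le_succ fun n => ?_)
    ⟨Real.pi, ?_⟩⟩
  · rw [Finset.sum_range_succ]
    refine le_add_of_nonneg_right (sub_nonneg.2 (Real.arctan_strictMono.monotone ?_))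
    gcongr
    linarith
  · rintro _ ⟨n, rfl⟩
    calc
      _ ≤ ∑ k ∈ Finset.range n, (Real.arctan ((2 * (k + 1 : ℕ) - 1) / y) -
          Real.arctan ((2 * k - 1) / y)) := by
        refine Finset.sum_le_sum fun k _ => sub_le_sub (Real.arctan_strictMono.monotone ?_)
          (Real.arctan_strictMono.monotone ?_)
        · gcongr
          push_cast
          linarith
        · gcongr
          linarith
      _ = Real.arctan ((2 * n - 1) / y) - Real.arctan ((2 * (0 : ℕ) - 1) / y) :=
        Finset.sum_range_sub (fun k : ℕ => Real.arctan ((2 * k - 1) / y)) n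
      _ ≤ Real.pi := by
        linarith [Real.arctan_lt_pi_div_two ((2 * n - 1) / y),
          Real.neg_pi_div_two_lt_arctan ((2 * (0 : ℕ) - 1) / y)]

theorem intervalIntegrable_exp_sub_exp_mul_sin_div {p q y T : ℝ} (hp : 0 ≤ p) (hq : 0 ≤ q)
    (hy : 0 ≤ y) (hT : 0 ≤ T) :
    IntervalIntegrable (fun t : ℝ =>
      (Real.exp (-(p * t)) - Real.exp (-(q * t))) * (Real.sin (y * t) / t)) volume 0 T := by
  refine intervalIntegrable_mul_sin_div (by fun_prop) (fun t ht => ?_) hy hT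
  have h₁ : Real.exp (-(p * t)) ≤ 1 := Real.exp_le_one_iff.2 (neg_nonpos.2 (by positivity))
  have h₂ : Real.exp (-(q * t)) ≤ 1 := Real.exp_le_one_iff.2 (neg_nonpos.2 (by positivity))
  rw [abs_le]
  constructor <;> linarith [Real.exp_pos (-(p * t)), Real.exp_pos (-(q * t))]

theorem intervalIntegrable_exp_mul_sinh_div_sinh_mul_sin_div {r y T : ℝ} (hr : 2 ≤ r)
    (hy : 0 ≤ y) (hT : 0 ≤ T) :
    IntervalIntegrable (fun t : ℝ => Real.exp (t / r) * Real.sinh (t / r) / Real.sinh t *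
      (Real.sin (y * t) / t)) volume 0 T := by
  refine intervalIntegrable_mul_sin_div (g := fun t => Real.exp (t / r) * Real.sinh (t / r) /
    Real.sinh t) (by fun_prop) (fun t ht => ?_) hy hT
  have h := exp_mul_sinh_div_sinh_mem_Icc hr ht
  exact (abs_of_nonneg h.1).trans_le h.2

theorem integral_const_mul_exp_neg_le {y c : ℝ} (T : ℝ) (hy : 0 ≤ y) (hc : 0 < c) :
    ∫ t in (0 : ℝ)..T, y * Real.exp (-(c * t)) ≤ y / c := by
  have h := integral_exp_neg_mul 0 T hc.ne'
  rw [intervalIntegral.integral_const_mul]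
  simp_rw [mul_comm c]
  rw [h, div_eq_mul_one_div y]
  gcongr
  simpa using (Real.exp_pos _).le

theorem abs_exp_mul_sinh_sub_sum_le {r y t : ℝ} (hr : 2 ≤ r) (hy : 0 ≤ y) (ht : 0 < t) (n : ℕ) :
    |Real.exp (t / r) * Real.sinh (t / r) / Real.sinh t * (Real.sin (y * t) / t) -
      ∑ k ∈ Finset.range n,
        (Real.exp (-((2 * k + 1 - 2 / r) * t)) - Real.exp (-((2 * k + 1) * t))) *
          (Real.sin (y * t) / t)| ≤ y * Real.exp (-(2 * n * t)) := by
  obtain ⟨h₀, h₁⟩ := exp_mul_sinh_div_sinh_mem_Icc hr ht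
  rw [← Finset.sum_mul, sum_exp_sub_exp_eq r ht.ne']
  generalize Real.exp (t / r) * Real.sinh (t / r) / Real.sinh t = K at h₀ h₁
  have hsin := abs_sin_mul_div_le hy ht
  generalize Real.sin (y * t) / t = s at hsin
  have hE := Real.exp_pos (-(2 * n * t))
  generalize Real.exp (-(2 * n * t)) = E at hE
  calc
    |K * s - K * (1 - E) * s| = K * (E * |s|) := by
      rw [show K * s - K * (1 - E) * s = K * (E * s) by ring, abs_mul, abs_mul,
        abs_of_nonneg h₀, abs_of_pos hE]
    _ ≤ E * |s| := mul_le_of_le_one_left (by positivity) h₁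
    _ ≤ y * E := by
      rw [mul_comm y]
      gcongr

theorem abs_integral_sub_sum_le {r y T : ℝ} (hr : 2 ≤ r) (hy : 0 < y) (hT : 0 ≤ T) {n : ℕ}
    (hn : n ≠ 0) :
    |(∫ t in (0 : ℝ)..T, Real.exp (t / r) * Real.sinh (t / r) / Real.sinh t *
        (Real.sin (y * t) / t)) -
      ∑ k ∈ Finset.range n, ∫ t in (0 : ℝ)..T,
        (Real.exp (-((2 * k + 1 - 2 / r) * t)) - Real.exp (-((2 * k + 1) * t))) *
          (Real.sin (y * t) / t)| ≤ y / 2 / n := by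
  have hr0 : 0 < r := by linarith
  have hr1 : 2 / r ≤ 1 := (div_le_one hr0).2 hr
  have hr2 : 0 < 2 / r := by positivity
  have hterm : ∀ k ∈ Finset.range n, IntervalIntegrable (fun t : ℝ =>
      (Real.exp (-((2 * k + 1 - 2 / r) * t)) - Real.exp (-((2 * k + 1) * t))) *
          (Real.sin (y * t) / t)) volume 0 T := fun k _ => by
    have hk : (0 : ℝ) ≤ k := k.cast_nonneg
    exact intervalIntegrable_exp_sub_exp_mul_sin_div (by linarith) (by linarith) hy.le hT
  have hsum : IntervalIntegrable (fun t : ℝ => ∑ k ∈ Finset.range n,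
      (Real.exp (-((2 * k + 1 - 2 / r) * t)) - Real.exp (-((2 * k + 1) * t))) *
          (Real.sin (y * t) / t)) volume 0 T :=
    ⟨integrable_finsetSum _ fun k hk => (hterm k hk).1,
      integrable_finsetSum _ fun k hk => (hterm k hk).2⟩
  have hK := intervalIntegrable_exp_mul_sinh_div_sinh_mul_sin_div hr hy.le hT
  rw [← intervalIntegral.integral_finsetSum hterm, ← intervalIntegral.integral_sub hK hsum,
    ← Real.norm_eq_abs, div_div]
  refine le_trans (intervalIntegral.norm_integral_le_of_norm_le hT
    (Eventually.of_forall fun t ht => ?_)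
    (Continuous.intervalIntegrable (u := fun t => y * Real.exp (-(2 * n * t))) (by fun_prop) _ _))
    (integral_const_mul_exp_neg_le T hy.le (by positivity))
  exact abs_exp_mul_sinh_sub_sum_le hr hy.le ht.1 n

theorem exists_tendsto_integral_and_tendsto_sum_arctan {r y : ℝ} (hr : 2 ≤ r) (hy : 0 < y) :
    ∃ L, Tendsto (fun T : ℝ => ∫ t in (0 : ℝ)..T,
        Real.exp (t / r) * Real.sinh (t / r) / Real.sinh t * (Real.sin (y * t) / t))
          atTop (nhds L) ∧
      Tendsto (fun n : ℕ => ∑ k ∈ Finset.range n,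
        (Real.arctan ((2 * k + 1) / y) - Real.arctan ((2 * k + 1 - 2 / r) / y)))
          atTop (nhds L) := by
  obtain ⟨L, hL⟩ := exists_tendsto_sum_arctan_sub_arctan hr hy
  have hr0 : 0 < r := by linarith
  have hr1 : 2 / r ≤ 1 := (div_le_one hr0).2 hr
  have hr2 : 0 < 2 / r := by positivity
  refine ⟨L, TendstoUniformlyOnFilter.tendsto_of_eventually_tendsto
    (F := fun (n : ℕ) (T : ℝ) => ∑ k ∈ Finset.range n, ∫ t in (0 : ℝ)..T,
        (Real.exp (-((2 * k + 1 - 2 / r) * t)) - Real.exp (-((2 * k + 1) * t))) *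
          (Real.sin (y * t) / t)) (p := atTop) ?_ (Eventually.of_forall fun n => ?_) hL, hL⟩
  · rw [Metric.tendstoUniformlyOnFilter_iff]
    intro ε hε
    have hsmall : ∀ᶠ n : ℕ in atTop, y / 2 / n < ε :=
      (tendsto_const_div_atTop_nhds_zero_nat (y / 2)).eventually_lt_const hε
    filter_upwards [(hsmall.and (eventually_ne_atTop 0)).prod_mk
      (eventually_ge_atTop (0 : ℝ))] with x hx
    rw [Real.dist_eq]
    exact (abs_integral_sub_sum_le hr hy hx.2 hx.1.2).trans_lt hx.1.1
  · refine tendsto_finsetSum _ fun k _ => ?_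
    have hk : (0 : ℝ) ≤ k := k.cast_nonneg
    exact tendsto_integral_exp_sub_exp_mul_sin_div (by linarith) (by linarith) hy

theorem integrableOn_exp_mul_sinh_mul_one_sub_cos {r : ℝ} (hr : 2 ≤ r) (y : ℝ) :
    IntegrableOn (fun t : ℝ => Real.exp (t / r) * Real.sinh (t / r) *
      (1 - Real.cos (y * t)) / (t * Real.sinh t ^ 2)) (Set.Ioi 0) := by
  have hexp : IntegrableOn (fun t : ℝ => y ^ 2 * Real.exp (-(1 / 2) * t)) (Set.Ioi 0) :=
    (exp_neg_integrableOn_Ioi 0 (by norm_num)).const_mul _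
  refine Integrable.mono' hexp (Measurable.aestronglyMeasurable (by fun_prop)) ?_
  filter_upwards [ae_restrict_mem measurableSet_Ioi] with t ht
  have ht0 : 0 < t := ht
  have hK := exp_mul_sinh_div_sinh_mem_Icc hr ht0
  have hsinh : 0 < Real.sinh t := Real.sinh_pos_iff.2 ht0
  have hcos0 : 0 ≤ 1 - Real.cos (y * t) := sub_nonneg.2 (Real.cos_le_one _)
  have hcos : 1 - Real.cos (y * t) ≤ (y * t) ^ 2 / 2 := by
    linarith [Real.one_sub_sq_div_two_le_cos (x := y * t)]
  have hsinh_ge : t * Real.exp (t / 2) / 2 ≤ Real.sinh t := by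
    have h₁ : Real.sinh t = 2 * Real.sinh (t / 2) * Real.cosh (t / 2) := by
      rw [← Real.sinh_two_mul]
      congr 1
      ring
    have h₂ : t / 2 ≤ Real.sinh (t / 2) := Real.self_le_sinh_iff.2 (by positivity)
    have h₃ : Real.exp (t / 2) / 2 ≤ Real.cosh (t / 2) := by
      rw [Real.cosh_eq]
      linarith [Real.exp_pos (-(t / 2))]
    rw [h₁]
    nlinarith [mul_le_mul h₂ h₃ (by positivity) (by linarith)]
  have hrw : Real.exp (t / r) * Real.sinh (t / r) * (1 - Real.cos (y * t)) /
      (t * Real.sinh t ^ 2) = Real.exp (t / r) * Real.sinh (t / r) / Real.sinh t *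
        ((1 - Real.cos (y * t)) / (t * Real.sinh t)) := by
    field_simp
  have hfrac : 0 ≤ (1 - Real.cos (y * t)) / (t * Real.sinh t) :=
    div_nonneg hcos0 (by positivity)
  rw [hrw, Real.norm_of_nonneg (mul_nonneg hK.1 hfrac)]
  refine (mul_le_of_le_one_left hfrac hK.2).trans ((div_le_iff₀ (by positivity)).2 ?_)
  have hone : Real.exp (-(1 / 2) * t) * Real.exp (t / 2) = 1 := by
    rw [← Real.exp_add, Real.exp_eq_one_iff]
    ring
  calc
    _ ≤ (y * t) ^ 2 / 2 := hcos
    _ = y ^ 2 * Real.exp (-(1 / 2) * t) * (t * (t * Real.exp (t / 2) / 2)) := by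
      linear_combination -(y * t) ^ 2 / 2 * hone
    _ ≤ _ := by gcongr

theorem tendsto_exp_sum_arctan {r y : ℝ} (hy : 0 < y) :
    Tendsto (fun n : ℕ => Complex.exp (-2 * I * ((∑ k ∈ Finset.range n,
        (Real.arctan ((2 * k + 1) / y) - Real.arctan ((2 * k + 1 - 2 / r) / y)) : ℝ) : ℂ)))
      atTop (nhds (Gamma (1 / 2 - I * y / 2) * Gamma (1 / 2 - 1 / r + I * y / 2) /
        (Gamma (1 / 2 + I * y / 2) * Gamma (1 / 2 - 1 / r - I * y / 2)))) := by
  have h₃ : ∀ m : ℕ, (1 / 2 + I * y / 2 : ℂ) ≠ -m := fun m h => by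
    have := congrArg Complex.im h
    simp at this
    exact hy.ne' this
  have h₄ : ∀ m : ℕ, (1 / 2 - 1 / r - I * y / 2 : ℂ) ≠ -m := fun m h => by
    have := congrArg Complex.im h
    simp [← Complex.ofReal_inv] at this
    exact hy.ne' this
  refine (tendsto_prod_Gamma_div (by ring) h₃ h₄).congr fun n => ?_
  rw [Complex.ofReal_sum, Finset.mul_sum, Complex.exp_sum]
  refine Finset.prod_congr rfl fun k _ => ?_
  rw [cexp_arctan_sub_arctan _ _ hy]
  push_cast
  rw [← mul_div_mul_left _ _ (by norm_num : (4 : ℂ) ≠ 0)]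
  congr 1 <;> ring

/-- Watson's equations for the minimal form factor `G(θ)` of one rank-1 and one
rank-(N−1) particle of the chiral SU(N) Gross–Neveu model, in integral form.
With `η = 2π/N`, `a(θ) = −Γ(1−θ/(2πi))Γ(1−1/N+θ/(2πi))/(Γ(1+θ/(2πi))Γ(1−1/N−θ/(2πi)))`
and `b(θ) = a(θ)·θ/(θ−iη)`:
(a) for real `θ > 0` the improper integral
`B(θ) = ∫₀^∞ (−2i)·e^{t/N}·sinh(t/N)·sin(tθ/π)/(t·sinh t) dt` exists and
`exp(B(θ)) = −b(iπ−θ)`, expressing `G(θ) = −G(−θ)·b(iπ−θ)`;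
(b) for every real `θ`, the integral
`∫₀^∞ e^{t/N}·sinh(t/N)·(1 − cos(tθ/π))/(t·sinh²t) dt` is absolutely convergent
and even in `θ`, expressing `G(iπ−θ) = G(iπ+θ)`. -/
theorem suN_minimal_form_factor_G_watson (N : ℕ) (hN : 2 ≤ N)
    (η : ℂ) (hη : η = 2 * Real.pi / N)
    (a b : ℂ → ℂ)
    (ha : ∀ θ : ℂ, a θ =
      -(Complex.Gamma (1 - θ / (2 * Real.pi * I)) *
          Complex.Gamma (1 - 1 / N + θ / (2 * Real.pi * I))) /
        (Complex.Gamma (1 + θ / (2 * Real.pi * I)) *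
          Complex.Gamma (1 - 1 / N - θ / (2 * Real.pi * I))))
    (hb : ∀ θ : ℂ, b θ = a θ * (θ / (θ - I * η))) :
    (∀ θ : ℝ, 0 < θ → ∃ B : ℂ,
      Tendsto (fun T : ℝ => ∫ t in (0 : ℝ)..T,
          (-2 * I) * ((Real.exp (t / N) * Real.sinh (t / N) *
            Real.sin (t * θ / Real.pi) / (t * Real.sinh t) : ℝ) : ℂ))
        atTop (nhds B) ∧
      Complex.exp B = -b (I * Real.pi - θ)) ∧
    (∀ θ : ℝ,
      IntegrableOn (fun t : ℝ =>
          Real.exp (t / N) * Real.sinh (t / N) *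
            (1 - Real.cos (t * θ / Real.pi)) / (t * Real.sinh t ^ 2))
        (Set.Ioi 0) ∧
      (∫ t in Set.Ioi (0 : ℝ),
          Real.exp (t / N) * Real.sinh (t / N) *
            (1 - Real.cos (t * θ / Real.pi)) / (t * Real.sinh t ^ 2)) =
        (∫ t in Set.Ioi (0 : ℝ),
          Real.exp (t / N) * Real.sinh (t / N) *
            (1 - Real.cos (t * (-θ) / Real.pi)) / (t * Real.sinh t ^ 2))) := by
  have hN' : (2 : ℝ) ≤ N := by exact_mod_cast hN
  have hpi : (Real.pi : ℂ) ≠ 0 := by exact_mod_cast Real.pi_ne_zero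
  refine ⟨fun θ hθ => ?_, fun θ => ⟨?_, by simp [neg_div]⟩⟩
  · have hy : 0 < θ / Real.pi := div_pos hθ Real.pi_pos
    obtain ⟨L, hint, hsum⟩ := exists_tendsto_integral_and_tendsto_sum_arctan hN' hy
    refine ⟨-2 * I * (L : ℂ), ?_, ?_⟩
    · refine ((continuous_ofReal.tendsto L).comp hint).const_mul (-2 * I) |>.congr fun T => ?_
      rw [intervalIntegral.integral_const_mul, Function.comp_apply,
        intervalIntegral.integral_ofReal]
      congr 3
      ext t
      rw [mul_comm _ t, mul_div_assoc t, div_mul_div_comm, mul_comm t (Real.sinh t)]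
    · have hcont : Continuous fun x : ℝ => Complex.exp (-2 * I * (x : ℂ)) := by fun_prop
      have hexp := (hcont.tendsto L).comp hsum
      refine (tendsto_nhds_unique hexp (tendsto_exp_sum_arctan hy)).trans ?_
      set y := θ / Real.pi with hydef
      have hθy : (θ : ℂ) = y * Real.pi := by
        rw [hydef]
        push_cast
        field_simp
      have hw : (I * Real.pi - θ) / (2 * Real.pi * I) = 1 / 2 + I * y / 2 := by
        rw [hθy]
        field_simp
        linear_combination -(y : ℂ) * I_sq
      have hne : ∀ c : ℝ, (c : ℂ) + I * y / 2 ≠ 0 := fun c h => hy.ne' (by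
        simpa using congrArg Complex.im h)
      have hz₃ : (1 / 2 + I * y / 2 : ℂ) ≠ 0 := by
        simpa using hne (1 / 2)
      have hz₂ : (1 / 2 - 1 / N + I * y / 2 : ℂ) ≠ 0 := by
        simpa using hne (1 / 2 - 1 / N)
      have hfrac : (I * Real.pi - θ) / (I * Real.pi - θ - I * η) =
          (1 / 2 + I * y / 2) / (1 / 2 - 1 / N + I * y / 2) := by
        have h2 : (2 * Real.pi * I : ℂ) ≠ 0 := by simp [hpi]
        have hnum : I * Real.pi - θ = 2 * Real.pi * I * (1 / 2 + I * y / 2) := by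
          rw [← hw]
          field_simp
        have hden : I * Real.pi - θ - I * η =
            2 * Real.pi * I * (1 / 2 - 1 / N + I * y / 2) := by
          rw [hnum, hη]
          ring
        rw [hden, hnum, mul_div_mul_left _ _ h2]
      have e₁ : (1 : ℂ) - (1 / 2 + I * y / 2) = 1 / 2 - I * y / 2 := by ring
      have e₂ : (1 : ℂ) - 1 / N + (1 / 2 + I * y / 2) = 1 / 2 - 1 / N + I * y / 2 + 1 := by ring
      have e₃ : (1 : ℂ) + (1 / 2 + I * y / 2) = 1 / 2 + I * y / 2 + 1 := by ring
      have e₄ : (1 : ℂ) - 1 / N - (1 / 2 + I * y / 2) = 1 / 2 - 1 / N - I * y / 2 := by ring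
      rw [hb, ha, hw, hfrac, e₁, e₂, e₃, e₄, Gamma_add_one _ hz₂, Gamma_add_one _ hz₃]
      push_cast
      generalize Gamma (1 / 2 - 1 / N - I * y / 2) = G₄
      generalize Gamma (1 / 2 - I * y / 2) = G₁
      generalize 1 / 2 + I * (y : ℂ) / 2 = z₃ at hz₃ ⊢
      generalize 1 / 2 - 1 / (N : ℂ) + I * y / 2 = z₂ at hz₂ ⊢
      field_simp
  · simpa only [mul_comm (θ / Real.pi), mul_div_assoc] using
      integrableOn_exp_mul_sinh_mul_one_sub_cos hN' (θ / Real.pi)
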